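/- arXiv:1407.4688 — 2 statements merged into one kernel-verified Lean document; each statement's English description precedes it below -/
import Mathlib

section
/- As t → 0⁺, the integral I₂(t) = ∫_{√t}^∞ π(s/t)·e^{−s} ds satisfies I₂(t) ~ 1/(t·log(1/t)), i.e. t·log(1/t)·I₂(t) → 1. -/
open Filter Topology

/-- `primePi y` is the number of primes not exceeding the real number `y`. -/
noncomputable def primePi (y : ℝ) : ℕ := Nat.primeCounting ⌊y⌋₊

/-- `I₂(t) = ∫_{√t}^∞ π(s/t)·e^{−s} ds`. -/
noncomputable def I₂ (t : ℝ) : ℝ :=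
  ∫ s in Set.Ioi (Real.sqrt t), (primePi (s / t) : ℝ) * Real.exp (-s)

section

open MeasureTheory

/-- The Fejér kernel, as the Fourier transform of the triangle function. -/
noncomputable def fejer (x : ℝ) : ℝ := ∫ y in (-1 : ℝ)..1, (1 - |y|) * Real.cos (x * y)

lemma continuous_fejer : Continuous fejer := by
  unfold fejer
  exact intervalIntegral.continuous_parametric_intervalIntegral_of_continuous'
    (by fun_prop) _ _

lemma fejer_ofReal_eq (x : ℝ) :
    (fejer x : ℂ) = ∫ y in (-1 : ℝ)..1, ((1 - |y| : ℝ) : ℂ) * Complex.exp (x * y * Complex.I) := by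
  have hsin : ∫ y in (-1 : ℝ)..1, (1 - |y|) * Real.sin (x * y) = 0 := by
    have h := intervalIntegral.integral_comp_neg (a := (-1 : ℝ)) (b := 1)
      (fun y => (1 - |y|) * Real.sin (x * y))
    simp only [abs_neg, mul_neg, Real.sin_neg, neg_neg, intervalIntegral.integral_neg] at h
    linarith
  have hexp (y : ℝ) : ((1 - |y| : ℝ) : ℂ) * Complex.exp (x * y * Complex.I) =
      (((1 - |y|) * Real.cos (x * y) : ℝ) : ℂ) +
        (((1 - |y|) * Real.sin (x * y) : ℝ) : ℂ) * Complex.I := by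
    rw [Complex.exp_mul_I]; push_cast; ring
  simp_rw [hexp]
  rw [intervalIntegral.integral_add
    (Continuous.intervalIntegrable (by fun_prop) _ _)
    (Continuous.intervalIntegrable (by fun_prop) _ _),
    intervalIntegral.integral_mul_const, intervalIntegral.integral_ofReal,
    intervalIntegral.integral_ofReal, hsin, fejer]
  simp

lemma fejer_eq {x : ℝ} (hx : x ≠ 0) : fejer x = 2 * (1 - Real.cos x) / x ^ 2 := by
  have hint (a b : ℝ) : IntervalIntegrable (fun y => (1 - |y|) * Real.cos (x * y)) volume a b :=
    Continuous.intervalIntegrable (by fun_prop) _ _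
  have hhalf : ∫ y in (0 : ℝ)..1, (1 - |y|) * Real.cos (x * y) = (1 - Real.cos x) / x ^ 2 := by
    have hcongr : ∫ y in (0 : ℝ)..1, (1 - |y|) * Real.cos (x * y) =
        ∫ y in (0 : ℝ)..1, (1 - y) * Real.cos (x * y) := by
      refine intervalIntegral.integral_congr fun y hy => ?_
      rw [Set.uIcc_of_le zero_le_one] at hy
      simp only [abs_of_nonneg hy.1]
    rw [hcongr, intervalIntegral.integral_eq_sub_of_hasDerivAt
      (f := fun y => (1 - y) * Real.sin (x * y) / x - Real.cos (x * y) / x ^ 2)]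
    · simp; ring
    · intro y _
      have hlin : HasDerivAt (fun y : ℝ => x * y) x y := by
        simpa using (hasDerivAt_id y).const_mul x
      have h := ((((hasDerivAt_id y).const_sub 1).mul hlin.sin).div_const x).sub
        (hlin.cos.div_const (x ^ 2))
      convert! h using 1
      simp only [id]
      field_simp
      ring
    · exact Continuous.intervalIntegrable (by fun_prop) _ _
  have hneg : ∫ y in (-1 : ℝ)..0, (1 - |y|) * Real.cos (x * y) =
      ∫ y in (0 : ℝ)..1, (1 - |y|) * Real.cos (x * y) := by
    have h := intervalIntegral.integral_comp_neg (a := (0 : ℝ)) (b := 1)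
      (fun y => (1 - |y|) * Real.cos (x * y))
    simpa [abs_neg, mul_neg, Real.cos_neg] using h.symm
  rw [fejer, ← intervalIntegral.integral_add_adjacent_intervals (hint (-1) 0) (hint 0 1), hneg,
    hhalf]
  ring

lemma fejer_zero : fejer 0 = 1 := by
  have hcont : Continuous fun y : ℝ => 1 - |y| := by fun_prop
  have hneg : ∫ y in (-1 : ℝ)..0, (1 - |y|) = 1 / 2 := by
    rw [intervalIntegral.integral_congr (g := fun y => 1 + y)]
    · rw [intervalIntegral.integral_add (by simp) (by simp)]
      norm_num
    · intro y hy
      rw [Set.uIcc_of_le (by norm_num)] at hy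
      simp [abs_of_nonpos hy.2]
  have hpos : ∫ y in (0 : ℝ)..1, (1 - |y|) = 1 / 2 := by
    rw [intervalIntegral.integral_congr (g := fun y => 1 - y)]
    · rw [intervalIntegral.integral_sub (by simp) (by simp)]
      norm_num
    · intro y hy
      rw [Set.uIcc_of_le (by norm_num)] at hy
      simp [abs_of_nonneg hy.1]
  simp only [fejer, zero_mul, Real.cos_zero, mul_one]
  rw [← intervalIntegral.integral_add_adjacent_intervals (b := 0)
    (hcont.intervalIntegrable _ _) (hcont.intervalIntegrable _ _), hneg, hpos]
  norm_num

lemma fejer_nonneg (x : ℝ) : 0 ≤ fejer x := by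
  rcases eq_or_ne x 0 with rfl | hx
  · simp [fejer_zero]
  · rw [fejer_eq hx]
    have := Real.cos_le_one x
    exact div_nonneg (by linarith) (by positivity)

lemma fejer_le (x : ℝ) : fejer x ≤ 8 * (1 + x ^ 2)⁻¹ := by
  rw [← div_eq_mul_inv, le_div_iff₀ (by positivity)]
  rcases eq_or_ne x 0 with rfl | hx
  · norm_num [fejer_zero]
  · rw [fejer_eq hx, div_mul_eq_mul_div, div_le_iff₀ (by positivity)]
    nlinarith [Real.one_sub_sq_div_two_le_cos (x := x), Real.neg_one_le_cos x, sq_nonneg x,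
      mul_nonneg (sq_nonneg x) (neg_le_iff_add_nonneg.1 (Real.neg_one_le_cos x))]

lemma integrable_fejer : Integrable fejer :=
  (integrable_inv_one_add_sq.const_mul 8).mono' continuous_fejer.aestronglyMeasurable
    (ae_of_all _ fun x => by
      rw [Real.norm_of_nonneg (fejer_nonneg x)]
      exact fejer_le x)

lemma integral_fejer_pos : 0 < ∫ x, fejer x :=
  integral_pos_of_integrable_nonneg_nonzero continuous_fejer integrable_fejer fejer_nonneg
    (x := 0) (by simp [fejer_zero])

lemma integrableOn_mul_exp_neg {f : ℝ → ℝ} {C ε : ℝ} (hf : Measurable f) (hC : ∀ t, |f t| ≤ C)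
    (hε : 0 < ε) : IntegrableOn (fun t => f t * Real.exp (-(ε * t))) (Set.Ioi 0) := by
  have hexp : IntegrableOn (fun t => Real.exp (-(ε * t))) (Set.Ioi 0) := by
    simpa using integrableOn_exp_mul_Ioi (neg_neg_of_pos hε) 0
  exact hexp.bdd_mul hf.aestronglyMeasurable (ae_of_all _ hC)

lemma integral_mul_exp_mul_fejer {f : ℝ → ℝ} {C : ℝ} {G : ℂ → ℂ} (hf : Measurable f)
    (hC : ∀ t, |f t| ≤ C)
    (hG : ∀ z : ℂ, 0 < z.re → ∫ t in Set.Ioi (0 : ℝ), (f t : ℂ) * Complex.exp (-(z * t)) = G z)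
    (l T : ℝ) {ε : ℝ} (hε : 0 < ε) :
    ((∫ t in Set.Ioi (0 : ℝ), f t * Real.exp (-(ε * t)) * fejer (l * (T - t)) : ℝ) : ℂ) =
      ∫ y in (-1 : ℝ)..1, ((1 - |y| : ℝ) : ℂ) * Complex.exp (l * T * y * Complex.I) *
        G (ε + l * y * Complex.I) := by
  set F : ℝ → ℝ → ℂ := fun y t => ((f t * Real.exp (-(ε * t)) : ℝ) : ℂ) *
    (((1 - |y| : ℝ) : ℂ) * Complex.exp ((l * (T - t) : ℝ) * y * Complex.I)) with hF
  have hint : Integrable (Function.uncurry F)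
      ((volume.restrict (Set.uIoc (-1 : ℝ) 1)).prod (volume.restrict (Set.Ioi 0))) := by
    have h1 : Integrable (fun y : ℝ => ((1 - |y| : ℝ) : ℂ))
        (volume.restrict (Set.uIoc (-1 : ℝ) 1)) :=
      (intervalIntegrable_iff.1 (Continuous.intervalIntegrable (by fun_prop) (-1) 1))
    have h2 : Integrable (fun t : ℝ => ((f t * Real.exp (-(ε * t)) : ℝ) : ℂ))
        (volume.restrict (Set.Ioi 0)) := (integrableOn_mul_exp_neg hf hC hε).ofReal
    have h3 := (h1.mul_prod h2).bdd_mul (c := 1)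
      (f := fun z : ℝ × ℝ => Complex.exp ((l * (T - z.2) : ℝ) * z.1 * Complex.I))
      (by exact Continuous.aestronglyMeasurable (by fun_prop))
      (ae_of_all _ fun z => by
        rw [← Complex.ofReal_mul, Complex.norm_exp_ofReal_mul_I])
    refine h3.congr (ae_of_all _ fun z => ?_)
    simp only [Function.uncurry, hF]
    ring
  have hswap := intervalIntegral_integral_swap hint
  rw [← integral_complex_ofReal]
  calc
    _ = ∫ t in Set.Ioi (0 : ℝ), ∫ y in (-1 : ℝ)..1, F y t := by
      refine integral_congr_ae (ae_of_all _ fun t => ?_)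
      simp only [hF]
      rw [intervalIntegral.integral_const_mul, ← fejer_ofReal_eq]
      push_cast
      ring
    _ = ∫ y in (-1 : ℝ)..1, ∫ t in Set.Ioi (0 : ℝ), F y t := hswap.symm
    _ = _ := by
      congr 1
      funext y
      rw [← hG _ (by simpa using hε), ← integral_const_mul]
      refine integral_congr_ae (ae_of_all _ fun t => ?_)
      simp only [hF]
      have hexp : Complex.exp (l * T * y * Complex.I) *
          Complex.exp (-((ε + l * y * Complex.I) * t)) =
          Complex.exp (-(ε * t)) * Complex.exp ((l * (T - t) : ℝ) * y * Complex.I) := by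
        rw [← Complex.exp_add, ← Complex.exp_add]
        congr 1
        push_cast
        ring
      push_cast at hexp ⊢
      linear_combination (-(1 - ((|y| : ℝ) : ℂ)) * (f t : ℂ)) * hexp

lemma integrable_fejer_comp {l : ℝ} (hl : l ≠ 0) (T : ℝ) :
    Integrable fun t => fejer (l * (T - t)) :=
  (integrable_fejer.comp_mul_left' hl).comp_sub_left T

lemma integral_mul_fejer {f : ℝ → ℝ} {C : ℝ} {G : ℂ → ℂ} (hf : Measurable f)
    (hC : ∀ t, |f t| ≤ C) (hGc : ContinuousOn G {z | 0 ≤ z.re})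
    (hG : ∀ z : ℂ, 0 < z.re → ∫ t in Set.Ioi (0 : ℝ), (f t : ℂ) * Complex.exp (-(z * t)) = G z)
    {l : ℝ} (hl : 0 < l) (T : ℝ) :
    ((∫ t in Set.Ioi (0 : ℝ), f t * fejer (l * (T - t)) : ℝ) : ℂ) =
      ∫ y in (-1 : ℝ)..1, ((1 - |y| : ℝ) : ℂ) * Complex.exp (l * T * y * Complex.I) *
        G (l * y * Complex.I) := by
  have hleft : Tendsto (fun ε : ℝ =>
      ∫ t in Set.Ioi (0 : ℝ), f t * Real.exp (-(ε * t)) * fejer (l * (T - t))) (𝓝[>] 0)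
      (𝓝 (∫ t in Set.Ioi (0 : ℝ), f t * fejer (l * (T - t)))) := by
    refine tendsto_integral_filter_of_dominated_convergence
      (fun t => C * fejer (l * (T - t))) ?_ ?_ ?_ ?_
    · refine Eventually.of_forall fun ε => Measurable.aestronglyMeasurable ?_
      have := continuous_fejer.measurable
      fun_prop
    · filter_upwards [self_mem_nhdsWithin] with ε hε
      refine (ae_restrict_mem measurableSet_Ioi).mono fun t ht => ?_
      rw [norm_mul, norm_mul, Real.norm_of_nonneg (fejer_nonneg _), Real.norm_of_nonneg
        (Real.exp_nonneg _)]
      have hexp : Real.exp (-(ε * t)) ≤ 1 :=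
        Real.exp_le_one_iff.2 (neg_nonpos.2 (mul_pos hε ht).le)
      refine mul_le_mul_of_nonneg_right ?_ (fejer_nonneg _)
      calc |f t| * Real.exp (-(ε * t)) ≤ |f t| * 1 := by gcongr
        _ ≤ C := by simpa using hC t
    · exact ((integrable_fejer_comp hl.ne' T).const_mul C).integrableOn
    · refine ae_of_all _ fun t => ?_
      have hcont : Continuous fun ε : ℝ => f t * Real.exp (-(ε * t)) * fejer (l * (T - t)) := by
        fun_prop
      simpa using (hcont.tendsto 0).mono_left nhdsWithin_le_nhds
  set K : Set ℂ := Set.Icc (0 : ℝ) 1 ×ℂ Set.Icc (-l) l with hK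
  have hKc : IsCompact K := isCompact_Icc.reProdIm isCompact_Icc
  obtain ⟨B, hB⟩ := hKc.exists_bound_of_continuousOn (hGc.mono fun z hz => hz.1.1)
  have hright : Tendsto (fun ε : ℝ =>
      ∫ y in (-1 : ℝ)..1, ((1 - |y| : ℝ) : ℂ) * Complex.exp (l * T * y * Complex.I) *
        G (ε + l * y * Complex.I)) (𝓝[>] 0)
      (𝓝 (∫ y in (-1 : ℝ)..1, ((1 - |y| : ℝ) : ℂ) * Complex.exp (l * T * y * Complex.I) *
        G (l * y * Complex.I))) := by
    refine intervalIntegral.tendsto_integral_filter_of_dominated_convergence (fun _ => B)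
      ?_ ?_ ?_ ?_
    · filter_upwards [self_mem_nhdsWithin] with ε hε
      have hGε : Continuous fun y : ℝ => G (ε + l * y * Complex.I) :=
        hGc.comp_continuous (by fun_prop) fun y => by simpa using (le_of_lt hε)
      exact (Continuous.mul (by fun_prop) hGε).aestronglyMeasurable
    · filter_upwards [Ioo_mem_nhdsGT (zero_lt_one (α := ℝ))] with ε hε
      refine ae_of_all _ fun y hy => ?_
      rw [Set.uIoc_of_le (by norm_num)] at hy
      have habs : |y| ≤ 1 := abs_le.2 ⟨hy.1.le, hy.2⟩
      have hmem : (ε + l * y * Complex.I : ℂ) ∈ K := by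
        rw [hK, Complex.mem_reProdIm]
        simp only [Complex.add_re, Complex.ofReal_re, Complex.mul_re, Complex.I_re, mul_zero,
          Complex.ofReal_im, Complex.I_im, mul_one, Complex.add_im, Complex.mul_im, zero_mul,
          Set.mem_Icc]
        constructor
        · constructor <;> linarith [hε.1, hε.2]
        · constructor <;> nlinarith [hy.1, hy.2]
      have hexp : ‖Complex.exp (l * T * y * Complex.I)‖ = 1 := by
        rw [← Complex.ofReal_mul, ← Complex.ofReal_mul, Complex.norm_exp_ofReal_mul_I]
      rw [norm_mul, norm_mul, hexp, mul_one, Complex.norm_real,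
        Real.norm_of_nonneg (by linarith)]
      have hBG := hB _ hmem
      nlinarith [norm_nonneg (G (ε + l * y * Complex.I)), abs_nonneg y]
    · exact intervalIntegrable_const
    · refine ae_of_all _ fun y _ => Tendsto.const_mul _ ?_
      have hmem : (l * y * Complex.I : ℂ) ∈ {z : ℂ | 0 ≤ z.re} := by simp
      have hpath : Tendsto (fun ε : ℝ => (ε + l * y * Complex.I : ℂ)) (𝓝[>] 0)
          (𝓝[{z : ℂ | 0 ≤ z.re}] (l * y * Complex.I)) := by
        refine tendsto_nhdsWithin_iff.2 ⟨?_, ?_⟩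
        · have hcont : Continuous fun ε : ℝ => (ε + l * y * Complex.I : ℂ) := by fun_prop
          simpa using (hcont.tendsto 0).mono_left nhdsWithin_le_nhds
        · filter_upwards [self_mem_nhdsWithin] with ε hε
          simpa using (le_of_lt hε)
      exact (hGc _ hmem).tendsto.comp hpath
  refine tendsto_nhds_unique ((Complex.continuous_ofReal.tendsto _).comp hleft)
    (hright.congr' ?_)
  filter_upwards [self_mem_nhdsWithin] with ε hε
  exact (integral_mul_exp_mul_fejer hf hC hG l T hε).symm

/-- If the Laplace transform of a bounded function extends continuously to the imaginary axis,
then its averages against translates of dilated Fejér kernels tend to zero. -/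
lemma tendsto_integral_mul_fejer {f : ℝ → ℝ} {C : ℝ} {G : ℂ → ℂ} (hf : Measurable f)
    (hC : ∀ t, |f t| ≤ C) (hGc : ContinuousOn G {z | 0 ≤ z.re})
    (hG : ∀ z : ℂ, 0 < z.re → ∫ t in Set.Ioi (0 : ℝ), (f t : ℂ) * Complex.exp (-(z * t)) = G z)
    {l : ℝ} (hl : 0 < l) :
    Tendsto (fun T => ∫ t in Set.Ioi (0 : ℝ), f t * fejer (l * (T - t))) atTop (𝓝 0) := by
  have hRL := Real.tendsto_integral_exp_smul_cocompact
    ((Set.Ioc (-1 : ℝ) 1).indicator fun y : ℝ => ((1 - |y| : ℝ) : ℂ) * G (l * y * Complex.I))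
  have hscale : Tendsto (fun T : ℝ => -(l / (2 * Real.pi)) * T) atTop (cocompact ℝ) := by
    refine Tendsto.mono_right (tendsto_id.const_mul_atTop_of_neg ?_) atBot_le_cocompact
    exact neg_neg_of_pos (by positivity)
  have hcomplex : Tendsto (fun T => ((∫ t in Set.Ioi (0 : ℝ), f t * fejer (l * (T - t)) : ℝ) : ℂ))
      atTop (𝓝 0) := by
    refine (hRL.comp hscale).congr fun T => ?_
    rw [integral_mul_fejer hf hC hGc hG hl T, intervalIntegral.integral_of_le (by norm_num),
      ← integral_indicator measurableSet_Ioc]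
    refine integral_congr_ae (ae_of_all _ fun y => ?_)
    by_cases hy : y ∈ Set.Ioc (-1 : ℝ) 1
    · simp only [Set.indicator_of_mem hy, Circle.smul_def, Real.fourierChar_apply, smul_eq_mul]
      have : (2 * Real.pi * -(y * (-(l / (2 * Real.pi)) * T)) : ℝ) = l * T * y := by
        field_simp
      rw [this]
      push_cast
      ring
    · simp [Set.indicator_of_notMem hy]
  exact_mod_cast (Complex.continuous_re.tendsto _).comp hcomplex

section Kernel

variable {F K : ℝ → ℝ} {C l δ : ℝ}

lemma integral_window_eq (hl : l ≠ 0) (c : ℝ) :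
    ∫ t in (c - δ)..(c + δ), K (l * (c - t)) = l⁻¹ * ∫ v in (-(l * δ))..(l * δ), K v := by
  rw [intervalIntegral.integral_comp_sub_left (fun u => K (l * u)),
    intervalIntegral.integral_comp_mul_left _ hl, smul_eq_mul]
  congr 2 <;> ring

lemma integral_dilate_eq (hl : 0 < l) (c : ℝ) : ∫ t, K (l * (c - t)) = l⁻¹ * ∫ v, K v := by
  rw [integral_sub_left_eq_self (fun u => K (l * u)), Measure.integral_comp_mul_left,
    abs_of_pos (by positivity), smul_eq_mul]

lemma integrable_dilate (hK : Integrable K) (hl : l ≠ 0) (c : ℝ) :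
    Integrable fun t => K (l * (c - t)) :=
  (hK.comp_mul_left' hl).comp_sub_left c

lemma integrable_mul_dilate (hF0 : ∀ t, 0 ≤ F t) (hFC : ∀ t, F t ≤ C)
    (hmono : Monotone fun t => F t * Real.exp t) (hK : Integrable K) (hl : l ≠ 0) (c : ℝ) :
    Integrable fun t => F t * K (l * (c - t)) := by
  have hmeas : Measurable F := by
    have h := hmono.measurable.mul (Real.measurable_exp.comp measurable_neg)
    convert! h using 1
    funext t
    simp [mul_assoc, ← Real.exp_add]
  refine (integrable_dilate hK hl c).bdd_mul (c := C) hmeas.aestronglyMeasurable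
    (ae_of_all _ fun t => ?_)
  rw [Real.norm_of_nonneg (hF0 t)]
  exact hFC t

lemma mul_le_integral_mul_dilate (hF0 : ∀ t, 0 ≤ F t) (hFC : ∀ t, F t ≤ C)
    (hmono : Monotone fun t => F t * Real.exp t) (hK0 : ∀ x, 0 ≤ K x) (hK : Integrable K)
    (hl : 0 < l) (hδ : 0 < δ) (T : ℝ) :
    F T * Real.exp (-(2 * δ)) * (l⁻¹ * ∫ v in (-(l * δ))..(l * δ), K v) ≤
      ∫ t, F t * K (l * (T + δ - t)) := by
  have hint := integrable_mul_dilate hF0 hFC hmono hK hl.ne' (T + δ)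
  rw [← integral_window_eq hl.ne' (T + δ), ← intervalIntegral.integral_const_mul,
    intervalIntegral.integral_of_le (by linarith)]
  refine le_trans (setIntegral_mono_on ((integrable_dilate hK hl.ne' _).const_mul _).integrableOn
    hint.integrableOn measurableSet_Ioc fun t ht => ?_)
    (setIntegral_le_integral hint (ae_of_all _ fun t => mul_nonneg (hF0 t) (hK0 _)))
  refine mul_le_mul_of_nonneg_right ?_ (hK0 _)
  have hTt := hmono (show T ≤ t by linarith [ht.1])
  calc F T * Real.exp (-(2 * δ)) ≤ F T * Real.exp (T - t) := by
        gcongr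
        · exact hF0 T
        · linarith [ht.2]
    _ = F T * Real.exp T * Real.exp (-t) := by rw [mul_assoc, ← Real.exp_add, sub_eq_add_neg]
    _ ≤ F t * Real.exp t * Real.exp (-t) := by gcongr
    _ = F t := by rw [mul_assoc, ← Real.exp_add]; simp

lemma integral_mul_dilate_le (hF0 : ∀ t, 0 ≤ F t) (hFC : ∀ t, F t ≤ C)
    (hmono : Monotone fun t => F t * Real.exp t) (hK0 : ∀ x, 0 ≤ K x) (hK : Integrable K)
    (hl : 0 < l) (hδ : 0 < δ) (T : ℝ) :
    ∫ t, F t * K (l * (T - δ - t)) ≤ F T * Real.exp (2 * δ) * (l⁻¹ * ∫ v, K v) +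
      C * (l⁻¹ * (∫ v, K v) - l⁻¹ * ∫ v in (-(l * δ))..(l * δ), K v) := by
  have hint := integrable_mul_dilate hF0 hFC hmono hK hl.ne' (T - δ)
  have hk := integrable_dilate hK hl.ne' (T - δ)
  have hC0 : 0 ≤ C := (hF0 0).trans (hFC 0)
  set S : Set ℝ := Set.Ioc (T - δ - δ) (T - δ + δ)
  have hind : Integrable (S.indicator fun t => K (l * (T - δ - t))) :=
    hk.indicator measurableSet_Ioc
  have hsub : Integrable fun t => K (l * (T - δ - t)) -
      S.indicator (fun t => K (l * (T - δ - t))) t := hk.sub hind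
  rw [← integral_window_eq hl.ne' (T - δ), intervalIntegral.integral_of_le (by linarith),
    ← integral_dilate_eq hl (T - δ), ← integral_indicator measurableSet_Ioc, ← integral_sub hk hind,
    ← integral_const_mul, ← integral_const_mul, ← integral_add (hk.const_mul _)
    (hsub.const_mul _)]
  refine integral_mono hint ((hk.const_mul _).add (hsub.const_mul _)) fun t => ?_
  by_cases ht : t ∈ S
  · simp only [Set.indicator_of_mem ht, sub_self, mul_zero, add_zero]
    refine mul_le_mul_of_nonneg_right ?_ (hK0 _)
    have htT := hmono (show t ≤ T by linarith [ht.2])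
    calc F t = F t * Real.exp t * Real.exp (-t) := by rw [mul_assoc, ← Real.exp_add]; simp
      _ ≤ F T * Real.exp T * Real.exp (-t) := by gcongr
      _ = F T * Real.exp (T - t) := by rw [mul_assoc, ← Real.exp_add, sub_eq_add_neg]
      _ ≤ F T * Real.exp (2 * δ) := by
        gcongr
        · exact hF0 T
        · linarith [ht.1]
  · simp only [Set.indicator_of_notMem ht, sub_zero]
    have h1 : 0 ≤ F T * Real.exp (2 * δ) * K (l * (T - δ - t)) :=
      mul_nonneg (mul_nonneg (hF0 T) (Real.exp_nonneg _)) (hK0 _)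
    have h2 := mul_le_mul_of_nonneg_right (hFC t) (hK0 (l * (T - δ - t)))
    linarith

/-- A slowly decreasing function whose averages against all dilates of an integrable nonnegative
kernel are asymptotic to those of the constant `1` tends to `1`. -/
lemma tendsto_one_of_tendsto_integral_mul_dilate (hF0 : ∀ t, 0 ≤ F t) (hFC : ∀ t, F t ≤ C)
    (hmono : Monotone fun t => F t * Real.exp t) (hK0 : ∀ x, 0 ≤ K x) (hK : Integrable K)
    (hM : 0 < ∫ v, K v)
    (hlim : ∀ l : ℝ, 0 < l →
      Tendsto (fun T => ∫ t, F t * K (l * (T - t))) atTop (𝓝 (l⁻¹ * ∫ v, K v))) :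
    Tendsto F atTop (𝓝 1) := by
  set M := ∫ v, K v
  set A : ℝ → ℝ := fun R => ∫ v in (-R)..R, K v with hA
  have hAlim : Tendsto A atTop (𝓝 M) :=
    intervalIntegral_tendsto_integral hK tendsto_neg_atTop_atBot tendsto_id
  have hexp (c : ℝ) : Tendsto (fun R : ℝ => Real.exp (c * R⁻¹)) atTop (𝓝 1) := by
    have h : Tendsto (fun R : ℝ => c * R⁻¹) atTop (𝓝 0) := by
      simpa using tendsto_inv_atTop_zero.const_mul c
    have h' := (Real.continuous_exp.tendsto 0).comp h
    rwa [Real.exp_zero] at h'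
  have hscale {R : ℝ} (hR : 0 < R) : R ^ 2 * R⁻¹ = R := by field_simp
  rw [tendsto_order]
  constructor
  · intro a ha
    have hlow : Tendsto (fun R => (M - C * (M - A R)) / (Real.exp (2 * R⁻¹) * M)) atTop (𝓝 1) := by
      have h := ((tendsto_const_nhds (x := M)).sub
        (((tendsto_const_nhds (x := M)).sub hAlim).const_mul C)).div ((hexp 2).mul_const M)
        (by simpa using hM.ne')
      convert! h using 2
      simp [hM.ne']
    obtain ⟨R, hR, hR0⟩ := ((hlow.eventually_const_lt ha).and (eventually_gt_atTop 0)).exists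
    have hl : 0 < R ^ 2 := by positivity
    have hJ := ((hlim _ hl).comp (tendsto_atTop_add_const_right atTop (-R⁻¹) tendsto_id))
    have hJ' := ((hJ.const_mul (R ^ 2)).sub_const (C * (M - A R))).div_const
      (Real.exp (2 * R⁻¹) * M)
    rw [mul_inv_cancel_left₀ hl.ne'] at hJ'
    filter_upwards [hJ'.eventually_const_lt hR] with T hT
    refine hT.trans_le ?_
    rw [div_le_iff₀ (by positivity)]
    have h := integral_mul_dilate_le hF0 hFC hmono hK0 hK hl (inv_pos.2 hR0) T
    rw [hscale hR0] at h
    have h' := mul_le_mul_of_nonneg_left h hl.le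
    simp only [Function.comp, id, ← sub_eq_add_neg]
    rw [show R ^ 2 * (F T * Real.exp (2 * R⁻¹) * ((R ^ 2)⁻¹ * M) +
      C * ((R ^ 2)⁻¹ * M - (R ^ 2)⁻¹ * A R)) = F T * (Real.exp (2 * R⁻¹) * M) + C * (M - A R) by
        field_simp] at h'
    linarith
  · intro a ha
    have hupp : Tendsto (fun R => M / (Real.exp (-2 * R⁻¹) * A R)) atTop (𝓝 1) := by
      have h := (tendsto_const_nhds (x := M)).div ((hexp (-2)).mul hAlim) (by simpa using hM.ne')
      convert! h using 2
      simp [hM.ne']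
    obtain ⟨R, ⟨hR, hR0⟩, hAR⟩ := (((hupp.eventually_lt_const ha).and (eventually_gt_atTop 0)).and
      (hAlim.eventually_const_lt hM)).exists
    have hl : 0 < R ^ 2 := by positivity
    have hJ := ((hlim _ hl).comp (tendsto_atTop_add_const_right atTop R⁻¹ tendsto_id))
    have hJ' := (hJ.const_mul (R ^ 2)).div_const (Real.exp (-2 * R⁻¹) * A R)
    rw [mul_inv_cancel_left₀ hl.ne'] at hJ'
    filter_upwards [hJ'.eventually_lt_const hR] with T hT
    refine lt_of_le_of_lt ?_ hT
    rw [le_div_iff₀ (by positivity)]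
    have h := mul_le_integral_mul_dilate hF0 hFC hmono hK0 hK hl (inv_pos.2 hR0) T
    rw [hscale hR0] at h
    have h' := mul_le_mul_of_nonneg_left h hl.le
    simp only [Function.comp, id]
    rw [show R ^ 2 * (F T * Real.exp (-(2 * R⁻¹)) * ((R ^ 2)⁻¹ * A R)) =
      F T * (Real.exp (-2 * R⁻¹) * A R) by rw [neg_mul]; field_simp] at h'
    exact h'

end Kernel

lemma integral_psi_exp_mul_exp {z : ℂ} (hz : 0 < z.re) :
    ∫ t in Set.Ioi (0 : ℝ), ((Chebyshev.psi (Real.exp t) * Real.exp (-t) : ℝ) : ℂ) *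
      Complex.exp (-(z * t)) =
      LSeries (fun n => (ArithmeticFunction.vonMangoldt n : ℂ)) (1 + z) / (1 + z) := by
  have hs : 1 + z ≠ 0 := fun h => by
    have := congrArg Complex.re h
    simp at this
    linarith
  have hO : (fun n : ℕ => ∑ k ∈ Finset.Icc 1 n, ArithmeticFunction.vonMangoldt k)
      =O[atTop] fun n => (n : ℝ) ^ (1 : ℝ) := by
    refine Asymptotics.IsBigO.of_bound (Real.log 4 + 4) (Eventually.of_forall fun n => ?_)
    have h := Chebyshev.psi_le_const_mul_self (x := n) n.cast_nonneg
    have h0 := Chebyshev.psi_nonneg (n : ℝ)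
    rw [Chebyshev.psi, Nat.floor_natCast] at h h0
    rw [Real.rpow_one, Real.norm_of_nonneg n.cast_nonneg]
    change ‖∑ k ∈ Finset.Ioc 0 n, _‖ ≤ _
    rwa [Real.norm_of_nonneg h0]
  rw [LSeries_eq_mul_integral_of_nonneg _ zero_le_one (by simpa using hz) hO
    (fun _ => ArithmeticFunction.vonMangoldt_nonneg), mul_div_cancel_left₀ _ hs, ← Real.exp_zero,
    ← integral_comp_exp_Ioi]
  refine setIntegral_congr_fun measurableSet_Ioi fun t _ => ?_
  have hsum : ∑ k ∈ Finset.Icc 1 ⌊Real.exp t⌋₊, (ArithmeticFunction.vonMangoldt k : ℂ) =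
      (Chebyshev.psi (Real.exp t) : ℂ) := by
    rw [Chebyshev.psi, Complex.ofReal_sum]
    rfl
  simp only [hsum]
  rw [Complex.cpow_def_of_ne_zero (by exact_mod_cast (Real.exp_pos t).ne'),
    ← Complex.ofReal_log (Real.exp_nonneg t), Real.log_exp, Complex.real_smul]
  push_cast
  have hexp : Complex.exp t * Complex.exp (t * -(1 + z + 1)) =
      Complex.exp (-t) * Complex.exp (-(z * t)) := by
    rw [← Complex.exp_add, ← Complex.exp_add]
    congr 1
    ring
  linear_combination (-(Chebyshev.psi (Real.exp t) : ℂ)) * hexp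

/-- The continuous extension to `0 ≤ re z` of the Laplace transform of `ψ(eᵗ)e⁻ᵗ - 1`. -/
noncomputable def psiLaplace (z : ℂ) : ℂ :=
  (ArithmeticFunction.vonMangoldt.LFunctionResidueClassAux (1 : ZMod 1) (1 + z) - 1) / (1 + z)

lemma continuousOn_psiLaplace : ContinuousOn psiLaplace {z | 0 ≤ z.re} := by
  refine ContinuousOn.div (((ArithmeticFunction.vonMangoldt.continuousOn_LFunctionResidueClassAux
    (1 : ZMod 1)).comp (by fun_prop) fun z hz => ?_).sub continuousOn_const) (by fun_prop)
    fun z hz h => ?_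
  · simpa using hz
  · have := congrArg Complex.re h
    simp at this hz
    linarith

lemma psi_exp_mul_exp_neg_nonneg (t : ℝ) : 0 ≤ Chebyshev.psi (Real.exp t) * Real.exp (-t) :=
  mul_nonneg (Chebyshev.psi_nonneg _) (Real.exp_nonneg _)

lemma psi_exp_mul_exp_neg_le (t : ℝ) :
    Chebyshev.psi (Real.exp t) * Real.exp (-t) ≤ Real.log 4 + 4 := by
  calc _ ≤ (Real.log 4 + 4) * Real.exp t * Real.exp (-t) := by
        gcongr
        exact Chebyshev.psi_le_const_mul_self (Real.exp_nonneg t)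
    _ = _ := by rw [mul_assoc, ← Real.exp_add]; simp

lemma measurable_psi_exp_mul_exp_neg :
    Measurable fun t => Chebyshev.psi (Real.exp t) * Real.exp (-t) :=
  (Chebyshev.psi_mono.measurable.comp Real.measurable_exp).mul
    (Real.measurable_exp.comp measurable_neg)

lemma abs_psi_exp_mul_exp_neg_sub_one_le (t : ℝ) :
    |Chebyshev.psi (Real.exp t) * Real.exp (-t) - 1| ≤ Real.log 4 + 4 := by
  have h0 := psi_exp_mul_exp_neg_nonneg t
  have h1 := psi_exp_mul_exp_neg_le t
  have h2 := Real.log_nonneg (show (1 : ℝ) ≤ 4 by norm_num)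
  rw [abs_le]
  constructor <;> linarith

lemma integral_psi_sub_one_mul_exp (z : ℂ) (hz : 0 < z.re) :
    ∫ t in Set.Ioi (0 : ℝ), ((Chebyshev.psi (Real.exp t) * Real.exp (-t) - 1 : ℝ) : ℂ) *
      Complex.exp (-(z * t)) = psiLaplace z := by
  have hexp : IntegrableOn (fun t : ℝ => Complex.exp (-(z * t))) (Set.Ioi 0) := by
    simpa using integrableOn_exp_mul_complex_Ioi (a := -z) (by simpa using hz) 0
  have hexp' : ∫ t in Set.Ioi (0 : ℝ), Complex.exp (-(z * t)) = 1 / z := by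
    simpa using integral_exp_mul_complex_Ioi (a := -z) (by simpa using hz) 0
  have hpsi : IntegrableOn (fun t : ℝ =>
      ((Chebyshev.psi (Real.exp t) * Real.exp (-t) : ℝ) : ℂ) * Complex.exp (-(z * t)))
      (Set.Ioi 0) := by
    refine hexp.bdd_mul (c := Real.log 4 + 4)
      (Complex.measurable_ofReal.comp measurable_psi_exp_mul_exp_neg).aestronglyMeasurable
      (ae_of_all _ fun t => ?_)
    rw [Complex.norm_real, Real.norm_of_nonneg (psi_exp_mul_exp_neg_nonneg t)]
    exact psi_exp_mul_exp_neg_le t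
  simp_rw [Complex.ofReal_sub, sub_mul, Complex.ofReal_one, one_mul]
  have hres : (fun n : ℕ => (ArithmeticFunction.vonMangoldt.residueClass (1 : ZMod 1) n : ℂ)) =
      fun n => (ArithmeticFunction.vonMangoldt n : ℂ) := by
    funext n
    rw [ArithmeticFunction.vonMangoldt.residueClass, Set.indicator_of_mem]
    exact Subsingleton.elim _ _
  have hre : (1 + z) ∈ {s : ℂ | 1 < s.re} := by simpa using hz
  have hz0 : z ≠ 0 := fun h => by simp [h] at hz
  have hs : 1 + z ≠ 0 := fun h => by
    have := congrArg Complex.re h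
    simp at this
    linarith
  rw [integral_sub hpsi hexp, hexp', integral_psi_exp_mul_exp hz, psiLaplace,
    ArithmeticFunction.vonMangoldt.eqOn_LFunctionResidueClassAux isUnit_one hre, hres]
  simp only [add_sub_cancel_left, Nat.totient_one]
  push_cast
  field_simp
  ring

lemma tendsto_setIntegral_Ioi_fejer {l : ℝ} (hl : 0 < l) :
    Tendsto (fun T => ∫ t in Set.Ioi (0 : ℝ), fejer (l * (T - t))) atTop
      (𝓝 (l⁻¹ * ∫ v, fejer v)) := by
  have h (T : ℝ) : ∫ t in Set.Ioi (0 : ℝ), fejer (l * (T - t)) =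
      ∫ u in Set.Iio T, fejer (l * u) := by
    rw [← integral_indicator measurableSet_Ioi, ← integral_indicator measurableSet_Iio,
      ← integral_sub_left_eq_self ((Set.Iio T).indicator fun u => fejer (l * u)) volume T]
    congr 1
    funext t
    simp [Set.indicator_apply]
  simp_rw [h]
  have hI : ∫ u, fejer (l * u) = l⁻¹ * ∫ v, fejer v := by
    rw [Measure.integral_comp_mul_left, abs_of_pos (by positivity), smul_eq_mul]
  rw [← hI]
  exact (aecover_Iio tendsto_id).integral_tendsto_of_countably_generated
    (integrable_fejer.comp_mul_left' hl.ne')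

lemma tendsto_integral_psi_mul_fejer {l : ℝ} (hl : 0 < l) :
    Tendsto (fun T => ∫ t, Chebyshev.psi (Real.exp t) * Real.exp (-t) * fejer (l * (T - t))) atTop
      (𝓝 (l⁻¹ * ∫ v, fejer v)) := by
  have h := (tendsto_integral_mul_fejer (measurable_psi_exp_mul_exp_neg.sub_const 1)
    abs_psi_exp_mul_exp_neg_sub_one_le continuousOn_psiLaplace integral_psi_sub_one_mul_exp hl).add
    (tendsto_setIntegral_Ioi_fejer hl)
  rw [zero_add] at h
  refine h.congr fun T => ?_
  have hk := integrable_fejer_comp hl.ne' T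
  have hf : Integrable fun t =>
      (Chebyshev.psi (Real.exp t) * Real.exp (-t) - 1) * fejer (l * (T - t)) :=
    hk.bdd_mul (measurable_psi_exp_mul_exp_neg.sub_const 1).aestronglyMeasurable
      (ae_of_all _ abs_psi_exp_mul_exp_neg_sub_one_le)
  rw [← integral_add hf.integrableOn hk.integrableOn, ← integral_indicator measurableSet_Ioi]
  congr 1
  funext t
  by_cases ht : t ∈ Set.Ioi (0 : ℝ)
  · rw [Set.indicator_of_mem ht]
    ring
  · have hexp : Real.exp t < 2 := by
      have := Real.exp_le_one_iff.2 (not_lt.1 ht)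
      linarith
    rw [Set.indicator_of_notMem ht, Chebyshev.psi_eq_zero_of_lt_two hexp]
    ring

theorem tendsto_psi_div_atTop : Tendsto (fun x => Chebyshev.psi x / x) atTop (𝓝 1) := by
  have h := (tendsto_one_of_tendsto_integral_mul_dilate psi_exp_mul_exp_neg_nonneg
    psi_exp_mul_exp_neg_le (fun a b hab => ?_) fejer_nonneg integrable_fejer integral_fejer_pos
    fun l hl => tendsto_integral_psi_mul_fejer hl).comp Real.tendsto_log_atTop
  · refine h.congr' ?_
    filter_upwards [eventually_gt_atTop 0] with x hx
    rw [Function.comp_apply, Real.exp_neg, Real.exp_log hx, div_eq_mul_inv]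
  · simp only [mul_assoc, ← Real.exp_add, neg_add_cancel, Real.exp_zero, mul_one]
    exact Chebyshev.psi_mono (Real.exp_le_exp.2 hab)

theorem tendsto_theta_div_atTop : Tendsto (fun x => Chebyshev.theta x / x) atTop (𝓝 1) := by
  have h : (fun x : ℝ => (Chebyshev.psi - Chebyshev.theta) x) =o[atTop] fun x : ℝ => x := by
    refine Chebyshev.isBigO_psi_sub_theta_sqrt.trans_isLittleO ?_
    rw [Asymptotics.isLittleO_iff_tendsto' (by
      filter_upwards [eventually_gt_atTop 0] with x hx h using absurd h hx.ne')]
    simp_rw [Real.sqrt_div_self]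
    exact (tendsto_inv_atTop_zero.comp Real.tendsto_sqrt_atTop).congr fun x => by simp
  have h' := tendsto_psi_div_atTop.sub h.tendsto_div_nhds_zero
  rw [sub_zero] at h'
  refine h'.congr fun x => ?_
  simp only [Pi.sub_apply]
  ring

/-- The **prime number theorem**. -/
theorem tendsto_primeCounting_mul_log_div :
    Tendsto (fun x : ℝ => Nat.primeCounting ⌊x⌋₊ * Real.log x / x) atTop (𝓝 1) := by
  have h : Tendsto (fun x : ℝ =>
      (Nat.primeCounting ⌊x⌋₊ - Chebyshev.theta x / Real.log x) / (x / Real.log x))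
      atTop (𝓝 0) := by
    refine (Chebyshev.primeCounting_sub_theta_div_log_isBigO.trans_isLittleO
      ?_).tendsto_div_nhds_zero
    have h1 : (fun x : ℝ => (Real.log x)⁻¹) =o[atTop] fun _ => (1 : ℝ) := by
      rw [Asymptotics.isLittleO_one_iff]
      exact tendsto_inv_atTop_zero.comp Real.tendsto_log_atTop
    refine ((Asymptotics.isBigO_refl (fun x : ℝ => x / Real.log x) atTop).mul_isLittleO h1).congr
      (fun x => ?_) fun x => mul_one _
    rw [pow_two, div_mul_eq_div_div, div_eq_mul_inv (x / Real.log x)]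
  have h' := h.add tendsto_theta_div_atTop
  rw [zero_add] at h'
  refine h'.congr' ?_
  filter_upwards [eventually_gt_atTop 1] with x hx
  have := (Real.log_pos hx).ne'
  have : x ≠ 0 := by positivity
  field_simp
  ring

lemma measurable_primePi : Measurable primePi :=
  (Nat.monotone_primeCounting.measurable).comp Nat.measurable_floor

lemma mul_log_mul_primePi_eq {s t : ℝ} (ht : 0 < t) (hs : 0 < s) (h : Real.log (s / t) ≠ 0) :
    t * Real.log (1 / t) * primePi (s / t) =
      primePi (s / t) * Real.log (s / t) / (s / t) * s * (Real.log (1 / t) / Real.log (s / t)) := by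
  field_simp

lemma tendsto_log_one_div : Tendsto (fun t : ℝ => Real.log (1 / t)) (𝓝[>] 0) atTop := by
  simp_rw [one_div]
  exact Real.tendsto_log_atTop.comp tendsto_inv_nhdsGT_zero

lemma tendsto_mul_log_mul_primePi {s : ℝ} (hs : 0 < s) :
    Tendsto (fun t : ℝ => t * Real.log (1 / t) * primePi (s / t)) (𝓝[>] 0) (𝓝 s) := by
  have hst : Tendsto (fun t : ℝ => s / t) (𝓝[>] 0) atTop :=
    tendsto_inv_nhdsGT_zero.const_mul_atTop hs
  have hlog : Tendsto (fun t : ℝ => Real.log (s / t)) (𝓝[>] 0) atTop :=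
    Real.tendsto_log_atTop.comp hst
  have hratio : Tendsto (fun t : ℝ => Real.log (1 / t) / Real.log (s / t)) (𝓝[>] 0) (𝓝 1) := by
    have h := (tendsto_const_nhds (x := (1 : ℝ))).sub
      (hlog.const_div_atTop (Real.log s))
    rw [sub_zero] at h
    refine h.congr' ?_
    filter_upwards [hlog.eventually_ne_atTop 0, self_mem_nhdsWithin] with t ht (ht0 : 0 < t)
    rw [eq_div_iff ht, sub_mul, div_mul_cancel₀ _ ht, one_mul, Real.log_div hs.ne' ht0.ne',
      one_div, Real.log_inv]
    ring
  have h := ((tendsto_primeCounting_mul_log_div.comp hst).mul_const s).mul hratio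
  rw [one_mul, mul_one] at h
  refine h.congr' ?_
  filter_upwards [hlog.eventually_ne_atTop 0, self_mem_nhdsWithin] with t ht ht0
  exact (mul_log_mul_primePi_eq ht0 hs ht).symm

lemma eventually_mul_log_mul_primePi_le :
    ∀ᶠ t : ℝ in 𝓝[>] 0, ∀ s, √t < s → t * Real.log (1 / t) * primePi (s / t) ≤ 4 * s := by
  obtain ⟨X, hX⟩ := eventually_atTop.1
    (tendsto_primeCounting_mul_log_div.eventually_le_const one_lt_two)
  have hsqrt : Tendsto (fun t : ℝ => √t⁻¹) (𝓝[>] 0) atTop :=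
    Real.tendsto_sqrt_atTop.comp tendsto_inv_nhdsGT_zero
  filter_upwards [self_mem_nhdsWithin, hsqrt.eventually_ge_atTop X,
    tendsto_log_one_div.eventually_gt_atTop 0] with t (ht : 0 < t) htX hL s hs
  have hs0 : 0 < s := (Real.sqrt_nonneg t).trans_lt hs
  have hle : √t⁻¹ ≤ s / t := by
    rw [le_div_iff₀ ht, Real.sqrt_inv, inv_mul_eq_div, Real.div_sqrt]
    exact hs.le
  have hlog : Real.log (1 / t) / 2 ≤ Real.log (s / t) := by
    rw [one_div, ← Real.log_sqrt (by positivity)]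
    exact Real.log_le_log (by positivity) hle
  have hpos : 0 < Real.log (s / t) := by linarith
  rw [mul_log_mul_primePi_eq ht hs0 hpos.ne']
  have h1 : primePi (s / t) * Real.log (s / t) / (s / t) ≤ 2 := hX _ (htX.trans hle)
  have h2 : Real.log (1 / t) / Real.log (s / t) ≤ 2 := by
    rw [div_le_iff₀ hpos]
    linarith
  calc _ ≤ 2 * s * 2 := by gcongr
    _ = 4 * s := by ring

lemma mul_log_mul_I₂_eq (t : ℝ) :
    t * Real.log (1 / t) * I₂ t = ∫ s in Set.Ioi (0 : ℝ), (Set.Ioi √t).indicator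
      (fun s => t * Real.log (1 / t) * primePi (s / t) * Real.exp (-s)) s := by
  rw [setIntegral_indicator measurableSet_Ioi, Set.Ioi_inter_Ioi,
    sup_eq_right.2 (Real.sqrt_nonneg t), I₂, ← integral_const_mul]
  simp_rw [mul_assoc]

end

theorem I2_asymptotic :
    Tendsto (fun t : ℝ => t * Real.log (1 / t) * I₂ t) (𝓝[>] 0) (𝓝 1) := by
  have hgamma : MeasureTheory.IntegrableOn (fun s : ℝ => s * Real.exp (-s)) (Set.Ioi 0) := by
    refine (Real.GammaIntegral_convergent (s := 2) two_pos).congr_fun (fun s _ => ?_)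
      measurableSet_Ioi
    norm_num [mul_comm]
  have hone : ∫ s in Set.Ioi (0 : ℝ), s * Real.exp (-s) = 1 := by
    rw [← Real.Gamma_two, Real.Gamma_eq_integral two_pos]
    norm_num [mul_comm]
  simp_rw [mul_log_mul_I₂_eq]
  rw [show 𝓝 (1 : ℝ) = 𝓝 (∫ s in Set.Ioi (0 : ℝ), s * Real.exp (-s)) by rw [hone]]
  refine MeasureTheory.tendsto_integral_filter_of_dominated_convergence
    (fun s => 4 * (s * Real.exp (-s))) ?_ ?_ (hgamma.const_mul 4) ?_
  · refine Eventually.of_forall fun t =>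
      (Measurable.indicator ?_ measurableSet_Ioi).aestronglyMeasurable
    have hcast : Measurable fun s : ℝ => (primePi (s / t) : ℝ) :=
      measurable_from_top.comp (measurable_primePi.comp (measurable_id.div_const t))
    fun_prop
  · filter_upwards [eventually_mul_log_mul_primePi_le, self_mem_nhdsWithin,
      tendsto_log_one_div.eventually_gt_atTop 0] with t hle (ht : 0 < t) hL
    filter_upwards [MeasureTheory.ae_restrict_mem measurableSet_Ioi] with s (hs : 0 < s)
    by_cases h : s ∈ Set.Ioi √t
    · rw [Set.indicator_of_mem h, Real.norm_of_nonneg (by positivity), ← mul_assoc]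
      exact mul_le_mul_of_nonneg_right (hle s h) (Real.exp_nonneg _)
    · rw [Set.indicator_of_notMem h, norm_zero]
      positivity
  · filter_upwards [MeasureTheory.ae_restrict_mem measurableSet_Ioi] with s (hs : 0 < s)
    refine ((tendsto_mul_log_mul_primePi hs).mul_const (Real.exp (-s))).congr' ?_
    have hsqrt : Tendsto (fun t : ℝ => √t) (𝓝[>] 0) (𝓝 0) := by
      simpa using (Real.continuous_sqrt.tendsto 0).mono_left nhdsWithin_le_nhds
    filter_upwards [hsqrt.eventually_lt_const hs] with t ht
    rw [Set.indicator_of_mem (show s ∈ Set.Ioi √t from ht)]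
end

section
/- For every fixed integer m ≥ 2, as z → 1⁻ one has m!·∑_{k≥m} Q_m(k)·z^k = f(z)^m + O(f(z)^{m−1}); that is, there exist constants C > 0 and z₀ ∈ (0,1) such that |m!·∑_{k≥m} Q_m(k)·z^k − f(z)^m| ≤ C·f(z)^{m−1} for all z₀ < z < 1. -/
open Filter Topology

/-- `Qm m n` is the number of multisets of `m` odd primes whose sum is `n`,
i.e. the number of partitions of `n` into exactly `m` odd prime parts. -/
noncomputable def Qm (m n : ℕ) : ℕ :=
  Nat.card {s : Multiset ℕ // Multiset.card s = m ∧ (∀ p ∈ s, Nat.Prime p ∧ Odd p) ∧ s.sum = n}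

/-- `f z = ∑_{p odd prime} z^p`. -/
noncomputable def f (z : ℝ) : ℝ := ∑' p : ℕ, if Nat.Prime p ∧ Odd p then z ^ p else 0

open scoped ENNReal

/-- The type of odd primes. -/
abbrev OddPrime := {p : ℕ // Nat.Prime p ∧ Odd p}

/-- The type of multisets of `m` odd primes. -/
abbrev OddPrimeMultiset (m : ℕ) :=
  {s : Multiset ℕ // Multiset.card s = m ∧ ∀ p ∈ s, Nat.Prime p ∧ Odd p}

/-- The multiset of entries of a tuple of odd primes. -/
def OddPrimeMultiset.ofTuple {m : ℕ} (v : Fin m → OddPrime) : OddPrimeMultiset m :=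
  ⟨Finset.univ.val.map fun i => (v i : ℕ), by simp, by
    intro p hp
    obtain ⟨i, -, rfl⟩ := Multiset.mem_map.1 hp
    exact (v i).2⟩

theorem OddPrimeMultiset.coe_ofTuple {m : ℕ} (v : Fin m → OddPrime) :
    (ofTuple v).1 = Finset.univ.val.map fun i => (v i : ℕ) := rfl

theorem OddPrimeMultiset.sum_ofTuple {m : ℕ} (v : Fin m → OddPrime) :
    (ofTuple v).1.sum = ∑ i, (v i : ℕ) := rfl

theorem OddPrimeMultiset.ofTuple_surjective (m : ℕ) :
    Function.Surjective (ofTuple (m := m)) := by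
  rintro ⟨s, hs, hp⟩
  induction s using Quotient.inductionOn with
  | _ l =>
    simp only [Multiset.quot_mk_to_coe, Multiset.coe_card] at hs
    subst hs
    refine ⟨fun i => ⟨l.get i, hp _ (by simp)⟩, Subtype.ext ?_⟩
    simp [ofTuple, Fin.univ_val_map]

theorem OddPrimeMultiset.ofTuple_comp_perm {m : ℕ} (v : Fin m → OddPrime)
    (σ : Equiv.Perm (Fin m)) : ofTuple (v ∘ σ) = ofTuple v := by
  refine Subtype.ext ?_
  rw [coe_ofTuple, coe_ofTuple]
  conv_rhs => rw [← Multiset.map_univ_val_equiv σ, Multiset.map_map]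
  rfl

theorem OddPrimeMultiset.exists_perm_of_ofTuple_eq {m : ℕ} {u v : Fin m → OddPrime}
    (h : ofTuple u = ofTuple v) : ∃ σ : Equiv.Perm (Fin m), v ∘ σ = u := by
  have key : ∀ c : OddPrime, Nonempty ({i // u i = c} ≃ {i // v i = c}) := by
    intro c
    refine ⟨Fintype.equivOfCardEq ?_⟩
    have h1 := congrArg (fun s => Multiset.count (c : ℕ) s.1) h
    simp only [ofTuple, Multiset.count_map] at h1
    rw [Fintype.card_subtype, Fintype.card_subtype]
    simpa [Finset.card, Finset.filter, Subtype.ext_iff, eq_comm] using h1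
  have e := fun c => (key c).some
  exact ⟨Equiv.ofFiberEquiv e, funext fun i => Equiv.ofFiberEquiv_map e i⟩

theorem OddPrimeMultiset.injective_of_nodup_ofTuple {m : ℕ} {v : Fin m → OddPrime}
    (h : (ofTuple v).1.Nodup) : Function.Injective v := by
  intro i j hij
  rw [coe_ofTuple] at h
  exact Multiset.inj_on_of_nodup_map h i (by simp) j (by simp) (by rw [hij])

theorem tsum_tuple_pow_sum (x : ℝ≥0∞) (m : ℕ) :
    ∑' v : Fin m → OddPrime, x ^ (∑ i, (v i : ℕ)) = (∑' p : OddPrime, x ^ (p : ℕ)) ^ m := by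
  induction m with
  | zero => simp
  | succ m ih =>
    rw [← (Fin.consEquiv fun _ : Fin (m + 1) => OddPrime).tsum_eq, ENNReal.tsum_prod', pow_succ',
      ← ENNReal.tsum_mul_right]
    refine tsum_congr fun p => ?_
    rw [← ih, ← ENNReal.tsum_mul_left]
    refine tsum_congr fun v => ?_
    simp [Fin.sum_univ_succ, pow_add, Fin.consEquiv]

theorem tsum_perm_prod (m : ℕ) {β : Type*} (g : β → ℝ≥0∞) :
    ∑' q : Equiv.Perm (Fin m) × β, g q.2 = (m.factorial : ℝ≥0∞) * ∑' b, g b := by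
  rw [ENNReal.tsum_prod']
  change ∑' _ : Equiv.Perm (Fin m), ∑' b, g b = _
  rw [ENNReal.tsum_const]
  simp [Fintype.card_perm]

theorem tsum_oddPrime_pow_le (x : ℝ≥0∞) (m : ℕ) :
    (∑' p : OddPrime, x ^ (p : ℕ)) ^ m ≤
      (m.factorial : ℝ≥0∞) * ∑' s : OddPrimeMultiset m, x ^ s.1.sum := by
  choose t ht using OddPrimeMultiset.ofTuple_surjective m
  let φ : Equiv.Perm (Fin m) × OddPrimeMultiset m → (Fin m → OddPrime) := fun q => t q.2 ∘ q.1
  have hφ : Function.Surjective φ := by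
    intro v
    obtain ⟨σ, hσ⟩ := OddPrimeMultiset.exists_perm_of_ofTuple_eq
      (ht (OddPrimeMultiset.ofTuple v)).symm
    exact ⟨(σ, _), hσ⟩
  rw [← tsum_tuple_pow_sum, ← tsum_perm_prod]
  refine (ENNReal.tsum_le_tsum_comp_of_surjective hφ _).trans_eq (tsum_congr fun q => ?_)
  rw [← OddPrimeMultiset.sum_ofTuple, OddPrimeMultiset.ofTuple_comp_perm, ht]

theorem factorial_mul_tsum_nodup_le (x : ℝ≥0∞) (m : ℕ) :
    (m.factorial : ℝ≥0∞) * ∑' s : {s : OddPrimeMultiset m | s.1.Nodup}, x ^ s.1.1.sum ≤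
      (∑' p : OddPrime, x ^ (p : ℕ)) ^ m := by
  choose t ht using OddPrimeMultiset.ofTuple_surjective m
  let φ : Equiv.Perm (Fin m) × {s : OddPrimeMultiset m | s.1.Nodup} → (Fin m → OddPrime) :=
    fun q => t q.2 ∘ q.1
  have hof (q) : OddPrimeMultiset.ofTuple (φ q) = q.2 := by
    rw [OddPrimeMultiset.ofTuple_comp_perm, ht]
  have hφ : Function.Injective φ := by
    rintro ⟨σ, s⟩ ⟨τ, s'⟩ h
    obtain rfl : s = s' := Subtype.ext (by rw [← hof (σ, s), h, hof])
    have hinj : Function.Injective (t s) :=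
      OddPrimeMultiset.injective_of_nodup_ofTuple (by rw [ht]; exact s.2)
    have : σ = τ := Equiv.ext fun i => hinj (congrFun h i)
    rw [this]
  rw [← tsum_tuple_pow_sum, ← tsum_perm_prod]
  refine le_trans (tsum_congr fun q => ?_).le (ENNReal.tsum_comp_le_tsum_of_injective hφ _)
  rw [← OddPrimeMultiset.sum_ofTuple, hof]

theorem tsum_not_nodup_le {x : ℝ≥0∞} (hx : x ≤ 1) (n : ℕ) :
    ∑' s : {s : OddPrimeMultiset (n + 2) | ¬ s.1.Nodup}, x ^ s.1.1.sum ≤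
      (∑' p : OddPrime, x ^ (p : ℕ)) ^ (n + 1) := by
  let φ : OddPrime × OddPrimeMultiset n → {s : OddPrimeMultiset (n + 2) | ¬ s.1.Nodup} :=
    fun q => ⟨⟨(q.1 : ℕ) ::ₘ (q.1 : ℕ) ::ₘ q.2.1, by simp [q.2.2.1], by
      simpa using ⟨q.1.2, q.2.2.2⟩⟩, by simp⟩
  let ψ : OddPrime × (Fin n → OddPrime) → {s : OddPrimeMultiset (n + 2) | ¬ s.1.Nodup} :=
    fun q => φ (q.1, OddPrimeMultiset.ofTuple q.2)
  have hψ : Function.Surjective ψ := by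
    rintro ⟨⟨s, hs, hp⟩, hd⟩
    simp only [Set.mem_ofPred_eq, Multiset.nodup_iff_le, not_forall, not_not] at hd
    obtain ⟨a, ha⟩ := hd
    obtain ⟨r, rfl⟩ := Multiset.le_iff_exists_add.1 ha
    obtain ⟨v, hv⟩ := OddPrimeMultiset.ofTuple_surjective n
      ⟨r, by simp at hs; omega, fun p h => hp p (by simp [h])⟩
    refine ⟨(⟨a, hp a (by simp)⟩, v), ?_⟩
    simp [ψ, φ, hv]
  refine (ENNReal.tsum_le_tsum_comp_of_surjective hψ _).trans ?_
  rw [ENNReal.tsum_prod', pow_succ', ← ENNReal.tsum_mul_right]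
  refine ENNReal.tsum_le_tsum fun p => ?_
  rw [← tsum_tuple_pow_sum, ← ENNReal.tsum_mul_left]
  refine ENNReal.tsum_le_tsum fun v => ?_
  rw [← pow_add]
  refine pow_le_pow_right_of_le_one' hx ?_
  simp [ψ, φ, OddPrimeMultiset.sum_ofTuple]

theorem factorial_mul_tsum_le {x : ℝ≥0∞} (hx : x ≤ 1) (n : ℕ) :
    ((n + 2).factorial : ℝ≥0∞) * ∑' s : OddPrimeMultiset (n + 2), x ^ s.1.sum ≤
      (∑' p : OddPrime, x ^ (p : ℕ)) ^ (n + 2) +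
        ((n + 2).factorial : ℝ≥0∞) * (∑' p : OddPrime, x ^ (p : ℕ)) ^ (n + 1) := by
  rw [← ENNReal.summable.tsum_add_tsum_compl (s := {s : OddPrimeMultiset (n + 2) | s.1.Nodup})
    ENNReal.summable, mul_add]
  exact add_le_add (factorial_mul_tsum_nodup_le x _) (mul_le_mul_right (tsum_not_nodup_le hx n) _)

theorem finite_oddPrime_multisets (m k : ℕ) :
    Finite {s : Multiset ℕ // Multiset.card s = m ∧ (∀ p ∈ s, Nat.Prime p ∧ Odd p) ∧ s.sum = k} :=
  Finite.of_injective
    (fun s => (⟨s.1, fun h => (s.2.2.1 _ h).1.pos, s.2.2.2⟩ : Nat.Partition k))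
    fun _ _ h => Subtype.ext (congrArg Nat.Partition.parts h)

theorem tsum_Qm_mul_pow (x : ℝ≥0∞) (m : ℕ) :
    ∑' k, (Qm m k : ℝ≥0∞) * x ^ k = ∑' s : OddPrimeMultiset m, x ^ s.1.sum := by
  rw [← (Equiv.sigmaFiberEquiv fun s : OddPrimeMultiset m => s.1.sum).tsum_eq, ENNReal.tsum_sigma']
  refine tsum_congr fun k => ?_
  have e : {s : OddPrimeMultiset m // s.1.sum = k} ≃
      {s : Multiset ℕ // Multiset.card s = m ∧ (∀ p ∈ s, Nat.Prime p ∧ Odd p) ∧ s.sum = k} :=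
    (Equiv.subtypeSubtypeEquivSubtypeInter _ fun s : Multiset ℕ => s.sum = k).trans
      (Equiv.subtypeEquivRight fun s => and_assoc)
  have := finite_oddPrime_multisets m k
  calc (Qm m k : ℝ≥0∞) * x ^ k = ∑' _ : {s : OddPrimeMultiset m // s.1.sum = k}, x ^ k := by
        rw [ENNReal.tsum_const, ENat.card_congr e, ENat.card_eq_coe_natCard]
        rfl
    _ = _ := tsum_congr fun s => by
        change x ^ k = x ^ s.1.1.sum
        rw [s.2]

theorem tsum_oddPrime_pow_ne_top {x : ℝ≥0∞} (hx : x < 1) : ∑' p : OddPrime, x ^ (p : ℕ) ≠ ∞ := by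
  refine ne_top_of_le_ne_top ?_
    (ENNReal.tsum_comp_le_tsum_of_injective Subtype.val_injective fun k : ℕ => x ^ k)
  rw [ENNReal.tsum_geometric]
  simpa [tsub_eq_zero_iff_le] using hx

theorem toReal_tsum_oddPrime_pow {z : ℝ} (hz : 0 ≤ z) :
    (∑' p : OddPrime, ENNReal.ofReal z ^ (p : ℕ)).toReal = f z := by
  rw [ENNReal.tsum_toReal_eq (by simp), f]
  simp only [ENNReal.toReal_pow, ENNReal.toReal_ofReal hz]
  refine (tsum_subtype {p : ℕ | Nat.Prime p ∧ Odd p} fun p => z ^ p).trans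
    (tsum_congr fun p => ?_)
  classical
  rw [Set.indicator_apply]
  congr

theorem toReal_tsum_Qm_mul_pow {z : ℝ} (hz : 0 ≤ z) (m : ℕ) :
    (∑' s : OddPrimeMultiset m, ENNReal.ofReal z ^ s.1.sum).toReal =
      ∑' k, (Qm m k : ℝ) * z ^ k := by
  rw [← tsum_Qm_mul_pow, ENNReal.tsum_toReal_eq
    fun k => ENNReal.mul_ne_top (ENNReal.natCast_ne_top _) (by simp)]
  simp [ENNReal.toReal_ofReal hz]

theorem gen_fun_m_parts_expansion (m : ℕ) (hm : 2 ≤ m) :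
    ∃ C > (0 : ℝ), ∃ z₀ : ℝ, 0 < z₀ ∧ z₀ < 1 ∧
      ∀ z : ℝ, z₀ < z → z < 1 →
        |(Nat.factorial m : ℝ) * (∑' k : ℕ, (Qm m k : ℝ) * z ^ k) - (f z) ^ m| ≤
          C * (f z) ^ (m - 1) := by
  obtain ⟨n, rfl⟩ := Nat.exists_eq_add_of_le' hm
  refine ⟨(n + 2).factorial, by positivity, 1 / 2, by norm_num, by norm_num, fun z hz hz1 => ?_⟩
  have hz0 : 0 ≤ z := by linarith
  have hx : ENNReal.ofReal z < 1 := by simpa using hz1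
  have hF := tsum_oddPrime_pow_ne_top hx
  have lower := tsum_oddPrime_pow_le (ENNReal.ofReal z) (n + 2)
  have upper := factorial_mul_tsum_le hx.le n
  have hright := ENNReal.add_ne_top.2 ⟨ENNReal.pow_ne_top (n := n + 2) hF,
    ENNReal.mul_ne_top (ENNReal.natCast_ne_top (n + 2).factorial)
      (ENNReal.pow_ne_top (n := n + 1) hF)⟩
  have lower' := ENNReal.toReal_mono (ne_top_of_le_ne_top hright upper) lower
  have upper' := ENNReal.toReal_mono hright upper
  rw [ENNReal.toReal_add (ENNReal.pow_ne_top hF)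
    (ENNReal.mul_ne_top (ENNReal.natCast_ne_top _) (ENNReal.pow_ne_top hF))] at upper'
  simp only [ENNReal.toReal_mul, ENNReal.toReal_pow, ENNReal.toReal_natCast,
    toReal_tsum_oddPrime_pow hz0, toReal_tsum_Qm_mul_pow hz0] at lower' upper'
  rw [abs_of_nonneg (sub_nonneg.2 lower'), show n + 2 - 1 = n + 1 from rfl]
  linarith
end
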